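/- For every integer n ≥ 3, in the set S_n(123,132,312): f_{213}(S_n(123,132,312)) = f_{231}(S_n(123,132,312)) = binom(n,3), and f_{321}(S_n(123,132,312)) = (n−2)·binom(n,3). -/

import Mathlib

open Finset

/-- Number of occurrences of the length-3 pattern `q` (given by its sequence of values)
in the permutation `σ` of `Fin n`: triples of indices `ι 0 < ι 1 < ι 2` whose values under
`σ` are in the same relative order as the values of `q`. -/
def occ (n : ℕ) (q : Fin 3 → ℕ) (σ : Equiv.Perm (Fin n)) : ℕ :=
  (Finset.univ.filter fun ι : Fin 3 → Fin n =>
    (∀ j l : Fin 3, j < l → ι j < ι l) ∧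
    (∀ j l : Fin 3, q j < q l ↔ σ (ι j) < σ (ι l))).card

/-- The set `S_n(R)` of permutations of `{1,…,n}` avoiding every pattern in `R`. -/
def avoiders (n : ℕ) (R : List (Fin 3 → ℕ)) : Finset (Equiv.Perm (Fin n)) :=
  Finset.univ.filter fun σ => ∀ q ∈ R, occ n q σ = 0

/-- `f_q(S_n(R))`: the total number of occurrences of the pattern `q` among
all permutations in `S_n(R)`. -/
def fCnt (n : ℕ) (q : Fin 3 → ℕ) (R : List (Fin 3 → ℕ)) : ℕ :=
  ∑ σ ∈ avoiders n R, occ n q σ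

def p123 : Fin 3 → ℕ := ![1, 2, 3]
def p132 : Fin 3 → ℕ := ![1, 3, 2]
def p213 : Fin 3 → ℕ := ![2, 1, 3]
def p231 : Fin 3 → ℕ := ![2, 3, 1]
def p312 : Fin 3 → ℕ := ![3, 1, 2]
def p321 : Fin 3 → ℕ := ![3, 2, 1]

theorem card_increasing (m n : ℕ) :
    #{ι : Fin m → Fin n | ∀ j l : Fin m, j < l → ι j < ι l} = n.choose m := by
  have e : {ι : Fin m → Fin n // ∀ j l : Fin m, j < l → ι j < ι l} ≃
      Set.powersetCard (Fin n) m :=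
    { toFun := fun ι => OrderEmbedding.ofStrictMono ι.1 fun j l h => ι.2 j l h
      invFun := fun f => ⟨f, fun _ _ h => f.strictMono h⟩
      left_inv := fun _ => rfl
      right_inv := fun _ => by ext; rfl : _ ≃ (Fin m ↪o Fin n) }.trans
      Set.powersetCard.ofFinEmbEquiv
  rw [← Fintype.card_subtype, ← Nat.card_eq_fintype_card, Nat.card_congr e]
  rw [Set.powersetCard.card, Nat.card_fin]

/-- The decreasing permutation with its largest value moved to position `k`. -/
def peakPerm {n : ℕ} (k : Fin n) : Equiv.Perm (Fin n) :=
  (Fin.cycleRange k).trans Fin.revPerm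

/-- The only ascents (not necessarily adjacent) of `σ` are those ending at position `k`. -/
def AscentsEndAt {n : ℕ} (k : Fin n) (σ : Equiv.Perm (Fin n)) : Prop :=
  ∀ x y, x < y → (σ x < σ y ↔ y = k)

theorem ascentsEndAt_peakPerm {n : ℕ} (k : Fin n) : AscentsEndAt k (peakPerm k) := by
  intro x y hxy
  have : NeZero n := ⟨by have := k.2; omega⟩
  have val (z : Fin n) : (Fin.cycleRange k z : ℕ) =
      if z < k then (z : ℕ) + 1 else if z = k then 0 else z := by
    split_ifs with h₁ h₂
    · exact Fin.coe_cycleRange_of_lt h₁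
    · simp [h₂]
    · rw [Fin.cycleRange_of_gt (lt_of_le_of_ne (not_lt.1 h₁) (Ne.symm h₂))]
  simp only [peakPerm, Equiv.trans_apply, Fin.revPerm_apply, Fin.rev_lt_rev]
  rw [Fin.lt_def, val, val]
  simp only [Fin.lt_def, Fin.ext_iff] at *
  split_ifs <;> omega

namespace AscentsEndAt

variable {n : ℕ} {k : Fin n} {σ τ : Equiv.Perm (Fin n)}

theorem gt_iff (h : AscentsEndAt k σ) {x y : Fin n} (hxy : x < y) : σ y < σ x ↔ y ≠ k := by
  rw [Ne, ← h x y hxy, not_lt, le_iff_lt_or_eq, or_iff_left]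
  exact fun e => hxy.ne' (σ.injective e)

theorem eq (hσ : AscentsEndAt k σ) (hτ : AscentsEndAt k τ) : σ = τ := by
  have key (x y : Fin n) : σ x < σ y ↔ τ x < τ y := by
    rcases lt_trichotomy x y with h | rfl | h
    · rw [hσ x y h, hτ x y h]
    · simp
    · rw [hσ.gt_iff h, hτ.gt_iff h]
  have mono : StrictMono (τ.symm.trans σ) := fun x y h => by
    simpa [key] using h
  have := Subsingleton.elim
    (StrictMono.orderIsoOfSurjective _ mono (τ.symm.trans σ).surjective) (OrderIso.refl _)
  ext x
  simpa using congrArg Fin.val (DFunLike.congr_fun this (τ x))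

end AscentsEndAt

theorem occ_eq_zero_iff {n : ℕ} {q : Fin 3 → ℕ} {σ : Equiv.Perm (Fin n)} :
    occ n q σ = 0 ↔ ∀ x y z : Fin n, x < y → y < z →
      ¬ ∀ j l : Fin 3, q j < q l ↔ σ (![x, y, z] j) < σ (![x, y, z] l) := by
  rw [occ, card_eq_zero, filter_eq_empty_iff]
  constructor
  · intro h x y z hxy hyz hq
    refine h (mem_univ ![x, y, z]) ⟨?_, hq⟩
    simp [Fin.forall_fin_succ, hxy, hyz, hxy.trans hyz]
  · rintro h ι - ⟨hι, hq⟩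
    refine h (ι 0) (ι 1) (ι 2) (hι _ _ (by decide)) (hι _ _ (by decide)) ?_
    have : ![ι 0, ι 1, ι 2] = ι := by ext i; fin_cases i <;> rfl
    rwa [this]

theorem mem_avoiders_iff {n : ℕ} {σ : Equiv.Perm (Fin n)} :
    σ ∈ avoiders n [p123, p132, p312] ↔ ∀ x y z : Fin n, x < y → y < z →
      ¬ (σ x < σ y ∧ σ y < σ z) ∧ ¬ (σ x < σ z ∧ σ z < σ y) ∧ ¬ (σ y < σ z ∧ σ z < σ x) := by
  simp only [avoiders, mem_filter, mem_univ, true_and, List.forall_mem_cons, List.not_mem_nil,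
    IsEmpty.forall_iff, implies_true, and_true, occ_eq_zero_iff, ← forall_and]
  refine forall_congr' fun x => forall_congr' fun y => forall_congr' fun z =>
    forall_congr' fun hxy => forall_congr' fun hyz => ?_
  refine and_congr (not_congr ?_) (and_congr (not_congr ?_) (not_congr ?_)) <;>
  · simp [Fin.forall_fin_succ, p123, p132, p312]
    grind

theorem exists_ascentsEndAt_iff {n : ℕ} [NeZero n] {σ : Equiv.Perm (Fin n)} :
    (∃ k, AscentsEndAt k σ) ↔ σ ∈ avoiders n [p123, p132, p312] := by
  rw [mem_avoiders_iff]
  constructor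
  · rintro ⟨k, h⟩ x y z hxy hyz
    have := h x y hxy
    have := h y z hyz
    have := h x z (hxy.trans hyz)
    grind
  · intro h
    refine ⟨σ.symm ⊤, fun x y hxy => ?_⟩
    set k := σ.symm ⊤ with hk
    have lt_top (x : Fin n) (hx : x ≠ k) : σ x < σ k := by
      rw [hk, Equiv.apply_symm_apply, lt_top_iff_ne_top]
      exact fun e => hx (by rw [hk, ← e, Equiv.symm_apply_apply])
    constructor
    · intro hlt
      by_contra hy
      have hyk := lt_top y hy
      rcases lt_trichotomy k x with hx | rfl | hx
      · exact (h k x y hx hxy).2.2 ⟨hlt, hyk⟩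
      · exact lt_asymm hlt hyk
      · rcases lt_or_gt_of_ne hy with hy | hy
        · exact (h x y k hxy hy).1 ⟨hlt, hyk⟩
        · exact (h x k y hx hy).2.1 ⟨hlt, hyk⟩
    · rintro rfl
      exact lt_top x hxy.ne

theorem peakPerm_injective {n : ℕ} [NeZero n] :
    Function.Injective (peakPerm : Fin n → Equiv.Perm (Fin n)) := by
  have (k : Fin n) : peakPerm k k = Fin.rev 0 := by simp [peakPerm]
  intro k l h
  exact (peakPerm l).injective (by rw [← h, this, h, this])

theorem avoiders_eq_image {n : ℕ} [NeZero n] :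
    avoiders n [p123, p132, p312] = univ.image peakPerm := by
  ext σ
  rw [← exists_ascentsEndAt_iff, mem_image]
  constructor
  · rintro ⟨k, h⟩
    exact ⟨k, mem_univ k, (ascentsEndAt_peakPerm k).eq h⟩
  · rintro ⟨k, -, rfl⟩
    exact ⟨k, ascentsEndAt_peakPerm k⟩

/-- Total pattern counts are obtained by counting, for each triple of positions, the peak
positions for which the pattern occurs there. -/
theorem fCnt_eq_mul_choose {n : ℕ} [NeZero n] {q : Fin 3 → ℕ} {c : ℕ}
    (h : ∀ ι : Fin 3 → Fin n, (∀ j l : Fin 3, j < l → ι j < ι l) →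
      #{k | ∀ j l : Fin 3, q j < q l ↔ peakPerm k (ι j) < peakPerm k (ι l)} = c) :
    fCnt n q [p123, p132, p312] = c * n.choose 3 := by
  rw [fCnt, avoiders_eq_image, sum_image peakPerm_injective.injOn]
  simp only [occ, ← filter_filter]
  simp only [card_filter _ (filter _ _)]
  rw [sum_comm]
  simp only [← card_filter]
  rw [sum_congr rfl fun ι hι => h ι (mem_filter.1 hι).2, sum_const, card_increasing, smul_eq_mul,
    mul_comm]

theorem peakPerm_pattern_iff {n : ℕ} {ι : Fin 3 → Fin n}
    (hι : ∀ j l : Fin 3, j < l → ι j < ι l) (k : Fin n) :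
    ((∀ j l : Fin 3, p213 j < p213 l ↔ peakPerm k (ι j) < peakPerm k (ι l)) ↔ k = ι 2) ∧
    ((∀ j l : Fin 3, p231 j < p231 l ↔ peakPerm k (ι j) < peakPerm k (ι l)) ↔ k = ι 1) ∧
    ((∀ j l : Fin 3, p321 j < p321 l ↔ peakPerm k (ι j) < peakPerm k (ι l)) ↔
      k ≠ ι 1 ∧ k ≠ ι 2) := by
  have h := ascentsEndAt_peakPerm k
  have h01 := hι 0 1 (by decide)
  have h12 := hι 1 2 (by decide)
  have h02 := hι 0 2 (by decide)
  simp [-not_lt, -Fin.not_lt, Fin.forall_fin_succ, p213, p231, p321, h _ _ h01, h _ _ h12,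
    h _ _ h02, h.gt_iff h01, h.gt_iff h12, h.gt_iff h02]
  clear h hι
  grind

/-- Pattern counts in `S_n(123,132,312)` for `n ≥ 3`:
`f_{213} = f_{231} = C(n,3)` and `f_{321} = (n−2)·C(n,3)`. -/
theorem stmt_18 (n : ℕ) (hn : 3 ≤ n) :
    (fCnt n p213 [p123, p132, p312] = n.choose 3 ∧
     fCnt n p231 [p123, p132, p312] = n.choose 3) ∧
    fCnt n p321 [p123, p132, p312] = (n - 2) * n.choose 3 := by
  have : NeZero n := ⟨by omega⟩
  refine ⟨⟨?_, ?_⟩, fCnt_eq_mul_choose fun ι hι => ?_⟩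
  · rw [fCnt_eq_mul_choose (c := 1), one_mul]
    intro ι hι
    simp [(peakPerm_pattern_iff hι _).1, filter_eq']
  · rw [fCnt_eq_mul_choose (c := 1), one_mul]
    intro ι hι
    simp [(peakPerm_pattern_iff hι _).2.1, filter_eq']
  · have hne : ι 1 ≠ ι 2 := (hι 1 2 (by decide)).ne
    have : (univ.filter fun k : Fin n => k ≠ ι 1 ∧ k ≠ ι 2) = ({ι 1, ι 2} : Finset (Fin n))ᶜ := by
      ext k
      simp
    simp only [(peakPerm_pattern_iff hι _).2.2, this]
    rw [card_compl, card_pair hne, Fintype.card_fin]
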